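/- arXiv:1709.07741 — 6 statements merged into one kernel-verified Lean document; each statement's English description precedes it below -/
import Mathlib

section
/- Let U be a commutative monoid with zero, T a type, and P a global predicate on states over (U, T). Then P is invariant under transposition: for every state s, P s ↔ P s⊤. -/
/-- A state over a PCM `U` and type `T`: (self, joint, other). -/
abbrev RState (U T : Type*) := U × T × U

variable {U T : Type*}

/-- The *self* component of a state. -/
def selfC (s : RState U T) : U := s.1
/-- The *joint* component of a state. -/
def jointC (s : RState U T) : T := s.2.1
/-- The *other* component of a state. -/
def otherC (s : RState U T) : U := s.2.2
/-- Transposition of a state: swap self and other components. -/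
def transp (s : RState U T) : RState U T := (s.2.2, s.2.1, s.1)

/-- Self-framing `s ◁ p`. -/
def frameSelf [CommMonoidWithZero U] (s : RState U T) (p : U) : RState U T :=
  (s.1 * p, s.2.1, s.2.2)
/-- Other-framing `s ▷ p`. -/
def frameOther [CommMonoidWithZero U] (s : RState U T) (p : U) : RState U T :=
  (s.1, s.2.1, p * s.2.2)

/-- A predicate on states is *global* if it is independent of the framing direction. -/
def Global [CommMonoidWithZero U] (P : RState U T → Prop) : Prop :=
  ∀ s p, P (frameSelf s p) ↔ P (frameOther s p)

/-- A global predicate is invariant under transposition of states. -/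
theorem stmt1 [CommMonoidWithZero U] (P : RState U T → Prop) (hP : Global P) :
    ∀ s : RState U T, P s ↔ P (transp s) := by
  rintro ⟨a, j, o⟩
  have h₁ := hP (a, j, 1) o
  have h₂ := hP (o, j, 1) a
  simp only [frameSelf, frameOther, mul_one] at h₁ h₂
  rw [mul_comm o a] at h₂
  exact h₁.symm.trans h₂
end

section
/- Let U be a commutative monoid with zero, T a type, and ⌊·⌋ a function from states over (U, T) to heaps satisfying ⌊s ◁ p⌋ = ⌊s ▷ p⌋ for all states s and all p : U. Then flattening is invariant under transposition: ⌊s⌋ = ⌊s⊤⌋ for every state s. -/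
variable {U T : Type*}

/-- Heaps: finite partial maps from pointers to values. -/
abbrev Heap (Ptr Val : Type*) [DecidableEq Ptr] := Finmap (fun _ : Ptr => Val)

/-- Flattening is invariant under transposition of states. -/
theorem stmt2 {Ptr Val : Type*} [DecidableEq Ptr] [CommMonoidWithZero U]
    (flat : RState U T → Heap Ptr Val)
    (hflat : ∀ (s : RState U T) (p : U), flat (frameSelf s p) = flat (frameOther s p)) :
    ∀ s : RState U T, flat s = flat (transp s) := by
  have key : ∀ (a o : U) (j : T), flat (a, j, o) = flat (1, j, a * o) := fun a o j => by
    simpa [frameSelf, frameOther] using hflat (1, j, o) a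
  rintro ⟨a, j, o⟩
  rw [transp, key a o j, key o a j, mul_comm]
end

section
/- Let S₁ and S₂ be state spaces over (U₁, T₁) and (U₂, T₂) with flattenings ⌊·⌋₁ and ⌊·⌋₂, and let t₁ be a transition over S₁ and t₂ a transition over S₂. Then the coupling t₁ * t₂, defined by (t₁ * t₂) s s' := t₁ (π₁ s) (π₁ s') ∧ t₂ (π₂ s) (π₂ s') ∧ Disjoint (keys ⌊π₁ s'⌋₁) (keys ⌊π₂ s'⌋₂), is a transition over the product state space S₁ × S₂: it satisfies functionality, other-fixity, locality, and (S₁ × S₂)-preservation. -/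
variable {U T : Type*}

/-- A state space: a valid, global predicate on states. -/
structure StateSpace [CommMonoidWithZero U] (S : RState U T → Prop) : Prop where
  valid : ∀ s, S s → selfC s * otherC s ≠ 0
  isGlobal : Global S

/-- A transition over a state space `S`: functional, other-fixed, local, `S`-preserving. -/
structure IsTransition [CommMonoidWithZero U] (S : RState U T → Prop)
    (t : RState U T → RState U T → Prop) : Prop where
  func : ∀ s s₁ s₂, t s s₁ → t s s₂ → s₁ = s₂
  otherFix : ∀ s s', t s s' → otherC s = otherC s'
  frameable : ∀ s p s', t (frameOther s p) s' →
    ∃ s'', s' = frameOther s'' p ∧ t (frameSelf s p) (frameSelf s'' p)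
  preserves : ∀ s s', t s s' → S s → S s'

variable {U₁ U₂ T₁ T₂ : Type*}

/-- First componentwise projection of a product state. -/
def proj1 (s : RState (U₁ × U₂) (T₁ × T₂)) : RState U₁ T₁ :=
  (s.1.1, s.2.1.1, s.2.2.1)

/-- Second componentwise projection of a product state. -/
def proj2 (s : RState (U₁ × U₂) (T₁ × T₂)) : RState U₂ T₂ :=
  (s.1.2, s.2.1.2, s.2.2.2)

/-- Pairing of states into a product state (pointwise in self, joint, other). -/
def spair (s₁ : RState U₁ T₁) (s₂ : RState U₂ T₂) : RState (U₁ × U₂) (T₁ × T₂) :=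
  ((s₁.1, s₂.1), (s₁.2.1, s₂.2.1), (s₁.2.2, s₂.2.2))

/-- Coupling of transitions `t₁ * t₂`, relative to flattenings `fl₁`, `fl₂`. -/
def couple {Ptr Val : Type*} [DecidableEq Ptr]
    (fl₁ : RState U₁ T₁ → Heap Ptr Val) (fl₂ : RState U₂ T₂ → Heap Ptr Val)
    (t₁ : RState U₁ T₁ → RState U₁ T₁ → Prop) (t₂ : RState U₂ T₂ → RState U₂ T₂ → Prop)
    (s s' : RState (U₁ × U₂) (T₁ × T₂)) : Prop :=
  t₁ (proj1 s) (proj1 s') ∧ t₂ (proj2 s) (proj2 s') ∧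
    Disjoint (fl₁ (proj1 s')).keys (fl₂ (proj2 s')).keys

/-- A product state is determined by its two projections. -/
theorem eq_of_proj_eq {s s' : RState (U₁ × U₂) (T₁ × T₂)}
    (h₁ : proj1 s = proj1 s') (h₂ : proj2 s = proj2 s') : s = s' := by
  simp only [proj1, proj2, Prod.mk.injEq] at h₁ h₂
  exact Prod.ext (Prod.ext h₁.1 h₂.1)
    (Prod.ext (Prod.ext h₁.2.1 h₂.2.1) (Prod.ext h₁.2.2 h₂.2.2))

/-- The coupling of two transitions is a transition over the product state space. -/
theorem stmt7 {Ptr Val : Type*} [DecidableEq Ptr]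
    [CommMonoidWithZero U₁] [CommMonoidWithZero U₂]
    (S₁ : RState U₁ T₁ → Prop) (hS₁ : StateSpace S₁)
    (S₂ : RState U₂ T₂ → Prop) (hS₂ : StateSpace S₂)
    (fl₁ : RState U₁ T₁ → Heap Ptr Val)
    (hfl₁ : ∀ s p, fl₁ (frameSelf s p) = fl₁ (frameOther s p))
    (fl₂ : RState U₂ T₂ → Heap Ptr Val)
    (hfl₂ : ∀ s p, fl₂ (frameSelf s p) = fl₂ (frameOther s p))
    (t₁ : RState U₁ T₁ → RState U₁ T₁ → Prop) (ht₁ : IsTransition S₁ t₁)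
    (t₂ : RState U₂ T₂ → RState U₂ T₂ → Prop) (ht₂ : IsTransition S₂ t₂) :
    IsTransition
      (fun s : RState (U₁ × U₂) (T₁ × T₂) =>
        S₁ (proj1 s) ∧ S₂ (proj2 s) ∧ Disjoint (fl₁ (proj1 s)).keys (fl₂ (proj2 s)).keys)
      (couple fl₁ fl₂ t₁ t₂) := by
  refine ⟨?_, ?_, ?_, ?_⟩
  · rintro s a b ⟨ha₁, ha₂, -⟩ ⟨hb₁, hb₂, -⟩
    exact eq_of_proj_eq (ht₁.func _ _ _ ha₁ hb₁) (ht₂.func _ _ _ ha₂ hb₂)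
  · rintro s s' ⟨h₁, h₂, -⟩
    exact Prod.ext (ht₁.otherFix _ _ h₁) (ht₂.otherFix _ _ h₂)
  · rintro s p s' ⟨h₁, h₂, hd⟩
    obtain ⟨a, ha, hta⟩ := ht₁.frameable (proj1 s) p.1 _ h₁
    obtain ⟨b, hb, htb⟩ := ht₂.frameable (proj2 s) p.2 _ h₂
    rw [ha, hb, ← hfl₁, ← hfl₂] at hd
    exact ⟨spair a b, eq_of_proj_eq ha hb, hta, htb, hd⟩
  · rintro s s' ⟨h₁, h₂, hd⟩ ⟨hs₁, hs₂, -⟩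
    exact ⟨ht₁.preserves _ _ h₁ hs₁, ht₂.preserves _ _ h₂ hs₂, hd⟩
end

section
/- Let U_A, U_B, U_C be commutative monoids with zero and T_A, T_B, T_C types, with states over each pair. Let R be a relation between states over (U_A, T_A) and states over (U_B, T_B) satisfying frame preservation with witness φ₁ : U_B → U_A: if (s_a, s_b ▷ p) ∈ R then there exists s_a'' with s_a = s_a'' ▷ φ₁ p and (s_a'' ◁ φ₁ p, s_b ◁ p) ∈ R. Let R' be a relation between states over (U_B, T_B) and states over (U_C, T_C) satisfying frame preservation with witness φ₂ : U_C → U_B. Then the relational composition R'' satisfies frame preservation with witness φ₁ ∘ φ₂: if (s_a, s_c ▷ p) ∈ R'' then there exists s_a'' with s_a = s_a'' ▷ (φ₁ (φ₂ p)) and (s_a'' ◁ φ₁ (φ₂ p), s_c ◁ p) ∈ R''. -/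
variable {U T : Type*}

/-- The frame-preservation property of morphisms is preserved under relational
composition, with the composed witness `φ₁ ∘ φ₂`. -/
theorem stmt13 {UA UB UC TA TB TC : Type*}
    [CommMonoidWithZero UA] [CommMonoidWithZero UB] [CommMonoidWithZero UC]
    (R : Set (RState UA TA × RState UB TB)) (R' : Set (RState UB TB × RState UC TC))
    (φ₁ : UB → UA) (φ₂ : UC → UB)
    (hR : ∀ (sa : RState UA TA) (sb : RState UB TB) (p : UB),
      (sa, frameOther sb p) ∈ R →
      ∃ sa'', sa = frameOther sa'' (φ₁ p) ∧ (frameSelf sa'' (φ₁ p), frameSelf sb p) ∈ R)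
    (hR' : ∀ (sb : RState UB TB) (sc : RState UC TC) (p : UC),
      (sb, frameOther sc p) ∈ R' →
      ∃ sb'', sb = frameOther sb'' (φ₂ p) ∧ (frameSelf sb'' (φ₂ p), frameSelf sc p) ∈ R') :
    ∀ (sa : RState UA TA) (sc : RState UC TC) (p : UC),
      (∃ sb, (sa, sb) ∈ R ∧ (sb, frameOther sc p) ∈ R') →
      ∃ sa'', sa = frameOther sa'' (φ₁ (φ₂ p)) ∧
        ∃ sb, (frameSelf sa'' (φ₁ (φ₂ p)), sb) ∈ R ∧ (sb, frameSelf sc p) ∈ R' := by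
  rintro sa sc p ⟨sb, hab, hbc⟩
  obtain ⟨sb'', rfl, hbc''⟩ := hR' sb sc p hbc
  obtain ⟨sa'', hsa, hab''⟩ := hR sa sb'' (φ₂ p) hab
  exact ⟨sa'', hsa, frameSelf sb'' (φ₂ p), hab'', hbc''⟩
end

section
/- Let V be a resource over a PCM U and type T, and let I be a global, V-inductive predicate on states. Then the restriction V/I is a resource: (a) the predicate (S_V ∧ I) s := S_V s ∧ I s is a state space (valid and global); (b) every internal transition t ∈ Δᵢ(V) is a transition over S_V ∧ I (in particular it preserves S_V ∧ I); and (c) for every external transition t ∈ Δₑ(V), the restricted relation t' defined by t' s s' := t s s' ∧ I s' is a transition over S_V ∧ I (satisfying functionality, other-fixity, locality, and (S_V ∧ I)-preservation). -/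
variable {U T : Type*}

/-- A resource (STS): a state space together with internal and external transitions. -/
structure Resource (U T : Type*) [CommMonoidWithZero U] where
  S : RState U T → Prop
  space : StateSpace S
  internalT : Set (RState U T → RState U T → Prop)
  externalT : Set (RState U T → RState U T → Prop)
  internal_trans : ∀ t ∈ internalT, IsTransition S t
  external_trans : ∀ t ∈ externalT, IsTransition S t

/-- Other-stepping of a resource: some transition fires on the transposed states. -/
def OStep [CommMonoidWithZero U] (V : Resource U T) (s s' : RState U T) : Prop :=
  ∃ t ∈ V.internalT ∪ V.externalT, t (transp s) (transp s')

/-- The restriction `V/I` of a resource `V` by a global, `V`-inductive invariant `I`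
is a resource: the restricted state space is a state space, the internal
transitions are transitions over it, and the restricted external transitions are
transitions over it. -/
theorem stmt16 [CommMonoidWithZero U] (V : Resource U T)
    (I : RState U T → Prop) (hIglob : Global I)
    (hInd : ∀ t ∈ V.internalT, ∀ s s', t s s' → I s → I s') :
    -- (a) the restricted state space is a state space
    StateSpace (fun s => V.S s ∧ I s) ∧
    -- (b) internal transitions of V are transitions over the restricted state space
    (∀ t ∈ V.internalT, IsTransition (fun s => V.S s ∧ I s) t) ∧
    -- (c) restricted external transitions are transitions over the restricted state space
    (∀ t ∈ V.externalT,
      IsTransition (fun s => V.S s ∧ I s) (fun s s' => t s s' ∧ I s')) := by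
  refine ⟨⟨fun s h => V.space.valid s h.1,
    fun s p => and_congr (V.space.isGlobal s p) (hIglob s p)⟩, fun t ht => ?_, fun t ht => ?_⟩
  · have h := V.internal_trans t ht
    exact ⟨h.func, h.otherFix, h.frameable,
      fun s s' hs hS => ⟨h.preserves s s' hs hS.1, hInd t ht s s' hs hS.2⟩⟩
  · have h := V.external_trans t ht
    refine ⟨fun s s₁ s₂ h₁ h₂ => h.func s s₁ s₂ h₁.1 h₂.1,
      fun s s' hs => h.otherFix s s' hs.1, ?_,
      fun s s' hs hS => ⟨h.preserves s s' hs.1 hS.1, hs.2⟩⟩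
    rintro s p s' ⟨hs, hI⟩
    obtain ⟨s'', rfl, hs''⟩ := h.frameable s p s' hs
    exact ⟨s'', rfl, hs'', (hIglob s'' p).2 hI⟩
end

section
/- Let V be a resource over a PCM U and type T whose state space S_V is global and all of whose transitions preserve S_V, and let I be a global, V-inductive predicate on states. Then the identity data — state relation {(s, s') | s = s' ∧ S_V s ∧ I s} and transition map t ↦ t — is a morphism from V to the restriction V/I: it satisfies (1) simulation of internal steps, (2) contravariant functionality, (3) simulation of other steps (every reflexive-transitive other-step of V/I from a state in S_V ∧ I is matched by a reflexive-transitive other-step of V), (4) frame preservation with witness φ = id, and (5) other-fixity. -/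
variable {U T : Type*}

/-- Other-stepping of the restriction `V/I`: internal transitions of `V`, or
external transitions of `V` restricted to preserve `I`, fired on transposed states. -/
def OStepRestrict [CommMonoidWithZero U] (V : Resource U T) (I : RState U T → Prop)
    (s s' : RState U T) : Prop :=
  (∃ t ∈ V.internalT, t (transp s) (transp s')) ∨
  (∃ t ∈ V.externalT, t (transp s) (transp s') ∧ I (transp s'))

/-- A global predicate is invariant under transposition: both sides collapse to the state
whose self component is `1` and whose other component is the total. -/
theorem Global.transp_iff [CommMonoidWithZero U] {P : RState U T → Prop} (hP : Global P)
    (s : RState U T) : P (transp s) ↔ P s := by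
  obtain ⟨a, j, o⟩ := s
  have h₁ := hP (1, j, o) a
  have h₂ := hP (1, j, a) o
  simp only [frameSelf, frameOther, one_mul] at h₁ h₂
  rw [mul_comm o a] at h₂
  exact h₂.trans h₁.symm

/-- Other-steps of the restriction preserve `V.S ∧ I`. -/
theorem OStepRestrict.preserves [CommMonoidWithZero U] {V : Resource U T}
    {I : RState U T → Prop} (hI : Global I)
    (hInd : ∀ t ∈ V.internalT, ∀ s s', t s s' → I s → I s') {s s' : RState U T}
    (h : OStepRestrict V I s s') (hs : V.S s ∧ I s) : V.S s' ∧ I s' := by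
  rw [← V.space.isGlobal.transp_iff, ← hI.transp_iff] at hs ⊢
  rcases h with ⟨t, ht, hst⟩ | ⟨t, ht, hst, hI'⟩
  · exact ⟨(V.internal_trans t ht).preserves _ _ hst hs.1, hInd t ht _ _ hst hs.2⟩
  · exact ⟨(V.external_trans t ht).preserves _ _ hst hs.1, hI'⟩

/-- Every other-step of the restriction is an other-step of the resource. -/
theorem OStepRestrict.oStep [CommMonoidWithZero U] {V : Resource U T}
    {I : RState U T → Prop} {s s' : RState U T} (h : OStepRestrict V I s s') :
    OStep V s s' := by
  rcases h with ⟨t, ht, hst⟩ | ⟨t, ht, hst, -⟩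
  · exact ⟨t, Or.inl ht, hst⟩
  · exact ⟨t, Or.inr ht, hst⟩

/-- The identity data (diagonal state relation restricted to the restricted state
space, identity on internal transitions) is a morphism from `V` to the
restriction `V/I`. -/
theorem stmt17 [CommMonoidWithZero U] (V : Resource U T)
    (I : RState U T → Prop) (hIglob : Global I)
    (hInd : ∀ t ∈ V.internalT, ∀ s s', t s s' → I s → I s') :
    let Rel : RState U T → RState U T → Prop := fun sv sw => sv = sw ∧ V.S sv ∧ I sv
    -- (1) simulation of internal steps, with identity transition map
    (∀ t ∈ V.internalT, ∀ sv sv' sw, t sv sv' → Rel sv sw →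
      ∃ sw', t sw sw' ∧ Rel sv' sw') ∧
    -- (2) contravariant functionality
    (∀ sv₁ sv₂ sw, Rel sv₁ sw → Rel sv₂ sw → sv₁ = sv₂) ∧
    -- (3) simulation of other steps: other-steps of V/I are matched by other-steps of V
    (∀ sw sw' sv, Relation.ReflTransGen (OStepRestrict V I) sw sw' → Rel sv sw →
      ∃ sv', Relation.ReflTransGen (OStep V) sv sv' ∧ Rel sv' sw') ∧
    -- (4) frame preservation with witness φ = id
    (∀ sv sw p, Rel sv (frameOther sw p) →
      ∃ sv'', sv = frameOther sv'' (id p) ∧ Rel (frameSelf sv'' (id p)) (frameSelf sw p)) ∧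
    -- (5) other-fixity
    (∀ sv sw sv' sw', Rel sv sw → Rel sv' sw' →
      otherC sw = otherC sw' → otherC sv = otherC sv') := by
  intro Rel
  refine ⟨?_, ?_, ?_, ?_, ?_⟩
  · rintro t ht sv sv' _ hst ⟨rfl, hS, hI⟩
    exact ⟨sv', hst, rfl, (V.internal_trans t ht).preserves _ _ hst hS, hInd t ht _ _ hst hI⟩
  · rintro sv₁ sv₂ sw ⟨h₁, -⟩ ⟨h₂, -⟩
    exact h₁.trans h₂.symm
  · rintro sw sw' _ hsteps ⟨rfl, hs⟩
    refine ⟨sw', Relation.ReflTransGen.mono (fun _ _ => OStepRestrict.oStep) _ _ hsteps, rfl, ?_⟩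
    induction hsteps with
    | refl => exact hs
    | tail _ hstep ih => exact hstep.preserves hIglob hInd ih
  · rintro _ sw p ⟨rfl, hS, hI⟩
    exact ⟨sw, rfl, rfl, (V.space.isGlobal sw p).mpr hS, (hIglob sw p).mpr hI⟩
  · rintro sv sw sv' sw' ⟨rfl, -⟩ ⟨rfl, -⟩ h
    exact h
end
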